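/- (Deterministic core inequality for the stochastic update) Let H and G be finite-dimensional real inner product spaces, f: H → ℝ convex and continuously differentiable with ‖∇f(x) − ∇f(y)‖_{Q⁻¹} ≤ β_f ‖x − y‖_Q for all x, y (Q self-adjoint positive definite on H, β_f > 0), g: H → (−∞,∞] and h: G → (−∞,∞] proper, convex and lower semicontinuous, L: H → G linear with adjoint L*, and Σ, Γ self-adjoint positive definite operators on G and H. On Z = G × H define S(y,x) = (Σ⁻¹y, Γ⁻¹x) and U(y,x) = (Σ⁻¹y − (1/2)Lx, −(1/2)L*y + Γ⁻¹x − (β_f/4)Qx). Let z* = (y*, x*) satisfy Lx* ∈ ∂h*(y*) and −(∇f(x*) + L*y*) ∈ ∂g(x*). Let z = (y,x) ∈ Z and w ∈ H, and set ŷ = prox^{Σ⁻¹}_{h*}(y + ΣLx), x̂ = prox^{Γ⁻¹}_g(x − Γ(∇f(x) + w) − ΓL*ŷ), and t = (ŷ + ΣL(x̂ − x), x̂). Then ⟨U(t − z), t − z⟩ ≤ ⟨S(t − z), z* − z⟩ + ⟨w, x* − x̂⟩. -/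

import Mathlib

open scoped RealInnerProductSpace

/-- An extended-real-valued function is convex. -/
def ERealConvexOn {H : Type*} [NormedAddCommGroup H] [InnerProductSpace ℝ H]
    (f : H → EReal) : Prop :=
  ∀ x y : H, ∀ a b : ℝ, 0 ≤ a → 0 ≤ b → a + b = 1 →
    f (a • x + b • y) ≤ (a : EReal) * f x + (b : EReal) * f y

/-- An extended-real-valued function is proper: nowhere `⊥` and not identically `⊤`. -/
def ERealProper {H : Type*} [NormedAddCommGroup H] [InnerProductSpace ℝ H]
    (f : H → EReal) : Prop :=
  (∀ x, f x ≠ ⊥) ∧ ∃ x, f x ≠ ⊤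

/-- The subdifferential `∂f(x) = {v | ∀ u, f x + ⟨v, u − x⟩ ≤ f u}`. -/
def ESubdiff {H : Type*} [NormedAddCommGroup H] [InnerProductSpace ℝ H]
    (f : H → EReal) (x : H) : Set H :=
  {v : H | ∀ u : H, f x + ((⟪v, u - x⟫ : ℝ) : EReal) ≤ f u}

/-- The Fenchel conjugate `f*(u) = sup_x {⟨x, u⟩ − f(x)}`. -/
noncomputable def econj {H : Type*} [NormedAddCommGroup H] [InnerProductSpace ℝ H]
    (f : H → EReal) (u : H) : EReal :=
  ⨆ x : H, ((⟪x, u⟫ : ℝ) : EReal) - f x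

/-- `p` is a minimizer of `u ↦ f(u) + (1/2)‖u − x‖²_Q`. -/
def IsWProx {H : Type*} [NormedAddCommGroup H] [InnerProductSpace ℝ H]
    (Q : H →ₗ[ℝ] H) (f : H → EReal) (x p : H) : Prop :=
  ∀ u : H, f p + ((1 / 2 * ⟪Q (p - x), p - x⟫ : ℝ) : EReal)
    ≤ f u + ((1 / 2 * ⟪Q (u - x), u - x⟫ : ℝ) : EReal)

/-- The weighted proximal operator `prox^Q_f(x)`, the (unique, under the standing
assumptions) minimizer of `u ↦ f(u) + (1/2)‖u − x‖²_Q`. -/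
noncomputable def wprox {H : Type*} [NormedAddCommGroup H] [InnerProductSpace ℝ H]
    (Q : H →ₗ[ℝ] H) (f : H → EReal) (x : H) : H :=
  Classical.epsilon (IsWProx Q f x)

section ExtendedRealConvexity

variable {E : Type*} [NormedAddCommGroup E] [InnerProductSpace ℝ E]

/-- A proper, convex, lower semicontinuous function has a continuous affine minorant. -/
lemma exists_affine_minorant [CompleteSpace E] {h : E → EReal} (h_proper : ERealProper h)
    (h_conv : ERealConvexOn h) (h_lsc : LowerSemicontinuous h) :
    ∃ (p : E) (c : ℝ), ∀ x, ((⟪x, p⟫ - c : ℝ) : EReal) ≤ h x := by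
  obtain ⟨h_bot, x₀, hx₀⟩ := h_proper
  lift h x₀ to ℝ using ⟨hx₀, h_bot x₀⟩ with r₀ hr₀
  set A : Set (E × ℝ) := {q | h q.1 ≤ ((q.2 : ℝ) : EReal)} with hA
  have hA_closed : IsClosed A :=
    h_lsc.isClosed_epigraph.preimage
      (continuous_fst.prodMk (continuous_coe_real_ereal.comp continuous_snd))
  have hA_conv : Convex ℝ A := by
    rintro ⟨x, r⟩ hx ⟨y, s⟩ hy a b ha hb hab
    simp only [hA, Set.mem_ofPred_eq, Prod.fst_add, Prod.smul_fst, Prod.snd_add, Prod.smul_snd,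
      smul_eq_mul, EReal.coe_add, EReal.coe_mul] at hx hy ⊢
    refine (h_conv x y a b ha hb hab).trans ?_
    have ha' : (0 : EReal) ≤ a := by exact_mod_cast ha
    have hb' : (0 : EReal) ≤ b := by exact_mod_cast hb
    gcongr
  have hA_notMem : (x₀, r₀ - 1) ∉ A := by
    simp only [hA, Set.mem_ofPred_eq, ← hr₀, EReal.coe_le_coe_iff]
    linarith
  obtain ⟨φ, u, hφ, hu⟩ := geometric_hahn_banach_closed_point hA_conv hA_closed hA_notMem
  set c := φ (0, 1) with hc
  have hφ_eq (x : E) (r : ℝ) : φ (x, r) = φ (x, 0) + r * c := by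
    rw [hc, ← smul_eq_mul, ← map_smul, ← map_add]
    simp
  have hc_neg : c < 0 := by
    have h₁ := hφ (x₀, r₀) (by simp [hA, ← hr₀])
    rw [hφ_eq] at h₁ hu
    linarith
  refine ⟨(-c)⁻¹ • (InnerProductSpace.toDual ℝ E).symm (φ.comp (.inl ℝ E ℝ)), u / (-c),
    fun x ↦ ?_⟩
  rcases eq_or_ne (h x) ⊤ with hx | hx
  · simp [hx]
  lift h x to ℝ using ⟨hx, h_bot x⟩ with r hr
  have h₁ := hφ (x, r) (by simp [hA, ← hr])
  rw [hφ_eq] at h₁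
  rw [EReal.coe_le_coe_iff, inner_smul_right, real_inner_comm,
    InnerProductSpace.toDual_symm_apply, inv_mul_eq_div, ← sub_div, div_le_iff₀ (by linarith)]
  simp only [ContinuousLinearMap.comp_apply, ContinuousLinearMap.inl_apply]
  linarith

lemma le_econj (h : E → EReal) (x u : E) : ((⟪x, u⟫ : ℝ) : EReal) - h x ≤ econj h u :=
  le_iSup (fun x : E ↦ ((⟪x, u⟫ : ℝ) : EReal) - h x) x

lemma econj_ne_bot {h : E → EReal} (h_proper : ERealProper h) (u : E) : econj h u ≠ ⊥ := by
  obtain ⟨h_bot, x, hx⟩ := h_proper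
  have hle := le_econj h x u
  lift h x to ℝ using ⟨hx, h_bot x⟩ with r
  intro hu
  rw [hu, ← EReal.coe_sub] at hle
  exact EReal.coe_ne_bot _ (le_bot_iff.mp hle)

lemma exists_econj_ne_top [CompleteSpace E] {h : E → EReal} (h_proper : ERealProper h)
    (h_conv : ERealConvexOn h) (h_lsc : LowerSemicontinuous h) : ∃ u, econj h u ≠ ⊤ := by
  obtain ⟨p, c, hpc⟩ := exists_affine_minorant h_proper h_conv h_lsc
  refine ⟨p, ((iSup_le fun x ↦ ?_).trans_lt (EReal.coe_lt_top c)).ne⟩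
  have hx := hpc x
  rcases eq_or_ne (h x) ⊤ with hx' | hx'
  · simp [hx']
  lift h x to ℝ using ⟨hx', h_proper.1 x⟩ with r
  norm_cast at hx ⊢
  linarith

lemma econj_convex {h : E → EReal} (h_bot : ∀ x, h x ≠ ⊥) : ERealConvexOn (econj h) := by
  intro u v a b ha hb hab
  refine iSup_le fun x ↦ ?_
  have hu := le_econj h x u
  have hv := le_econj h x v
  rcases eq_or_ne (h x) ⊤ with hx | hx
  · simp [hx]
  lift h x to ℝ using ⟨hx, h_bot x⟩ with r
  have ha' : (0 : EReal) ≤ a := by exact_mod_cast ha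
  have hb' : (0 : EReal) ≤ b := by exact_mod_cast hb
  calc ((⟪x, a • u + b • v⟫ : ℝ) : EReal) - r
      = a * ((⟪x, u⟫ : ℝ) - r) + b * ((⟪x, v⟫ : ℝ) - r) := by
        norm_cast
        rw [inner_add_right, inner_smul_right, inner_smul_right]
        linear_combination r * hab
    _ ≤ a * econj h u + b * econj h v := by gcongr

lemma econj_lowerSemicontinuous {h : E → EReal} (h_bot : ∀ x, h x ≠ ⊥) :
    LowerSemicontinuous (econj h) := by
  refine lowerSemicontinuous_iSup fun x ↦ Continuous.lowerSemicontinuous ?_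
  rcases eq_or_ne (h x) ⊤ with hx | hx
  · simpa [hx] using continuous_const
  lift h x to ℝ using ⟨hx, h_bot x⟩ with r
  simp only [← EReal.coe_sub]
  exact continuous_coe_real_ereal.comp (by fun_prop)

lemma ne_top_of_mem_ESubdiff {F : E → EReal} {z v : E} (hv : v ∈ ESubdiff F z)
    (hF : ∃ u, F u ≠ ⊤) : F z ≠ ⊤ := by
  obtain ⟨u, hu⟩ := hF
  intro hz
  have := hv u
  rw [hz, EReal.top_add_coe] at this
  exact hu (top_le_iff.mp this)

end ExtendedRealConvexity

section WeightedProx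

variable {E : Type*} [NormedAddCommGroup E] [InnerProductSpace ℝ E]

/-- The inverse of a positive definite operator is coercive. -/
lemma exists_coercive_of_inverse [FiniteDimensional ℝ E] {Q P : E →ₗ[ℝ] E}
    (hP_sa : ∀ x y : E, ⟪P x, y⟫ = ⟪x, P y⟫) (hP_pd : ∀ x : E, x ≠ 0 → 0 < ⟪P x, x⟫)
    (hPQ : ∀ x, P (Q x) = x) :
    ∃ c > 0, ∀ x, c * ‖x‖ ^ 2 ≤ ⟪Q x, x⟫ := by
  have hP_nonneg (x : E) : 0 ≤ ⟪P x, x⟫ := by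
    rcases eq_or_ne x 0 with rfl | hx
    · simp
    · exact (hP_pd x hx).le
  set C : ℝ := ‖LinearMap.toContinuousLinearMap P‖ + 1 with hC
  have hC_pos : 0 < C := by positivity
  refine ⟨C⁻¹, inv_pos.mpr hC_pos, fun x ↦ ?_⟩
  have hbound : ⟪P x, x⟫ ≤ C * ‖x‖ ^ 2 := by
    have h₁ : ‖P x‖ ≤ ‖LinearMap.toContinuousLinearMap P‖ * ‖x‖ :=
      (LinearMap.toContinuousLinearMap P).le_opNorm x
    have h₂ := real_inner_le_norm (P x) x
    nlinarith [norm_nonneg x, mul_le_mul_of_nonneg_right h₁ (norm_nonneg x), sq_nonneg ‖x‖]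
  have hsq := hP_nonneg (Q x - C⁻¹ • x)
  have hcross : ⟪P x, Q x⟫ = ‖x‖ ^ 2 := by rw [hP_sa, hPQ, real_inner_self_eq_norm_sq]
  simp only [map_sub, map_smul, hPQ, inner_sub_left, inner_sub_right, inner_smul_left,
    inner_smul_right, hcross, real_inner_self_eq_norm_sq, RCLike.conj_to_real] at hsq
  rw [real_inner_comm] at hsq
  have hb2 : C⁻¹ * (C⁻¹ * ⟪P x, x⟫) ≤ C⁻¹ * ‖x‖ ^ 2 := by
    rw [inv_mul_le_iff₀ hC_pos, inv_mul_le_iff₀ hC_pos, mul_inv_cancel_left₀ hC_pos.ne']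
    exact hbound
  linarith

/-- The weighted proximal point exists for a lower semicontinuous function that has a subgradient
at a point of its domain. -/
lemma exists_isWProx [FiniteDimensional ℝ E] {Q : E →ₗ[ℝ] E}
    (hQ_sa : ∀ x y : E, ⟪Q x, y⟫ = ⟪x, Q y⟫) {c : ℝ} (hc : 0 < c)
    (hQc : ∀ x, c * ‖x‖ ^ 2 ≤ ⟪Q x, x⟫) {F : E → EReal} (hF_lsc : LowerSemicontinuous F)
    {z v : E} (hv : v ∈ ESubdiff F z) (x : E) : ∃ p, IsWProx Q F x p := by
  have hQ_cont : Continuous Q := Q.continuous_of_finiteDimensional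
  have hlsc : LowerSemicontinuous
      (fun u ↦ F u + ((1 / 2 * ⟪Q (u - x), u - x⟫ : ℝ) : EReal)) := by
    refine hF_lsc.add' (Continuous.lowerSemicontinuous ?_) fun u ↦
      EReal.continuousAt_add (.inr (EReal.coe_ne_bot _)) (.inr (EReal.coe_ne_top _))
    exact continuous_coe_real_ereal.comp (by fun_prop)
  set m := v + Q (z - x) with hm
  have hR : 0 ≤ 2 * ‖m‖ / c := by positivity
  obtain ⟨p, -, hp⟩ := LowerSemicontinuousOn.exists_isMinOn
    ⟨z, Metric.mem_closedBall_self hR⟩ (isCompact_closedBall z (2 * ‖m‖ / c))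
    (hlsc.lowerSemicontinuousOn _)
  refine ⟨p, fun u ↦ ?_⟩
  by_cases hu : u ∈ Metric.closedBall z (2 * ‖m‖ / c)
  · exact hp hu
  refine (hp (Metric.mem_closedBall_self hR)).trans ?_
  have hu' : 2 * ‖m‖ < ‖u - z‖ * c := by
    rw [Metric.mem_closedBall, not_le, dist_eq_norm, div_lt_iff₀ hc] at hu
    exact hu
  have hquad : 1 / 2 * ⟪Q (z - x), z - x⟫ ≤
      ⟪v, u - z⟫ + 1 / 2 * ⟪Q (u - x), u - x⟫ := by
    have hsplit : u - x = (u - z) + (z - x) := by abel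
    have hexp : ⟪Q (u - x), u - x⟫ =
        ⟪Q (u - z), u - z⟫ + 2 * ⟪Q (z - x), u - z⟫ + ⟪Q (z - x), z - x⟫ := by
      rw [hsplit, map_add, inner_add_left, inner_add_right, inner_add_right,
        hQ_sa (u - z) (z - x), real_inner_comm (Q (z - x)) (u - z)]
      ring
    have hmle : -(‖m‖ * ‖u - z‖) ≤ ⟪m, u - z⟫ :=
      neg_le_of_abs_le (abs_real_inner_le_norm m (u - z))
    have hmeq : ⟪m, u - z⟫ = ⟪v, u - z⟫ + ⟪Q (z - x), u - z⟫ := by rw [hm, inner_add_left]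
    have h₁ := hQc (u - z)
    have h₂ := mul_le_mul_of_nonneg_right hu'.le (norm_nonneg (u - z))
    rw [hexp]
    nlinarith
  calc F z + ((1 / 2 * ⟪Q (z - x), z - x⟫ : ℝ) : EReal)
      ≤ F z + ((⟪v, u - z⟫ + 1 / 2 * ⟪Q (u - x), u - x⟫ : ℝ) : EReal) := by
        gcongr
    _ = F z + ((⟪v, u - z⟫ : ℝ) : EReal) + ((1 / 2 * ⟪Q (u - x), u - x⟫ : ℝ) : EReal) := by
        rw [EReal.coe_add, add_assoc]
    _ ≤ F u + ((1 / 2 * ⟪Q (u - x), u - x⟫ : ℝ) : EReal) := by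
        gcongr
        exact hv u

lemma nonneg_of_forall_add_mul_nonneg {a b : ℝ}
    (h : ∀ t : ℝ, 0 < t → t ≤ 1 → 0 ≤ a + t * b) : 0 ≤ a := by
  by_contra! ha
  have h₁ := h 1 one_pos le_rfl
  have hb : 0 < b := by linarith
  have h₂ := h (-a / (2 * b)) (by apply div_pos <;> linarith)
    (by rw [div_le_one (by linarith)]; linarith)
  have h₃ : -a / (2 * b) * b = -a / 2 := by field_simp
  linarith

/-- Variational inequality characterizing weighted proximal points. -/
lemma IsWProx.inner_add_le {Q : E →ₗ[ℝ] E} (hQ_sa : ∀ x y : E, ⟪Q x, y⟫ = ⟪x, Q y⟫)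
    {F : E → EReal} (hF_conv : ERealConvexOn F) {x p z : E} (hp : IsWProx Q F x p) {a b : ℝ}
    (ha : F p = a) (hb : F z = b) : a + ⟪Q (x - p), z - p⟫ ≤ b := by
  suffices 0 ≤ b - a + ⟪Q (p - x), z - p⟫ by
    have hneg : ⟪Q (x - p), z - p⟫ = -⟪Q (p - x), z - p⟫ := by
      rw [← inner_neg_left, ← map_neg, neg_sub]
    linarith
  refine nonneg_of_forall_add_mul_nonneg (b := 1 / 2 * ⟪Q (z - p), z - p⟫) fun t ht ht1 ↦ ?_
  have h₁ := hp ((1 - t) • p + t • z)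
  have h₂ := hF_conv p z (1 - t) t (by linarith) ht.le (by ring)
  rw [ha, hb] at h₂
  have h₃ := h₁.trans (add_le_add_left h₂ _)
  rw [ha] at h₃
  norm_cast at h₃
  have hsplit : (1 - t) • p + t • z - x = (p - x) + t • (z - p) := by module
  have hexp : ⟪Q ((1 - t) • p + t • z - x), (1 - t) • p + t • z - x⟫ =
      ⟪Q (p - x), p - x⟫ + 2 * t * ⟪Q (p - x), z - p⟫ + t ^ 2 * ⟪Q (z - p), z - p⟫ := by
    rw [hsplit, map_add, map_smul]
    simp only [inner_add_left, inner_add_right, inner_smul_left, inner_smul_right,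
      RCLike.conj_to_real]
    rw [hQ_sa (z - p) (p - x), real_inner_comm (Q (p - x)) (z - p)]
    ring
  rw [hexp] at h₃
  refine nonneg_of_mul_nonneg_right (a := t) ?_ ht
  linarith

/-- The weighted proximal point satisfies a monotonicity inequality against any subgradient. -/
lemma inner_sub_wprox_le_zero [FiniteDimensional ℝ E] {Q P : E →ₗ[ℝ] E}
    (hP_sa : ∀ x y : E, ⟪P x, y⟫ = ⟪x, P y⟫) (hP_pd : ∀ x : E, x ≠ 0 → 0 < ⟪P x, x⟫)
    (hPQ : ∀ x, P (Q x) = x) {F : E → EReal} (hF_bot : ∀ x, F x ≠ ⊥)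
    (hF_dom : ∃ u, F u ≠ ⊤) (hF_conv : ERealConvexOn F) (hF_lsc : LowerSemicontinuous F)
    {z v : E} (hv : v ∈ ESubdiff F z) (x : E) :
    ⟪Q (x - wprox Q F x) - v, z - wprox Q F x⟫ ≤ 0 := by
  have hQ_sa (x y : E) : ⟪Q x, y⟫ = ⟪x, Q y⟫ := by rw [← hPQ y, ← hP_sa, hPQ, hPQ]
  obtain ⟨c, hc, hQc⟩ := exists_coercive_of_inverse hP_sa hP_pd hPQ
  have hp : IsWProx Q F x (wprox Q F x) :=
    Classical.epsilon_spec (exists_isWProx hQ_sa hc hQc hF_lsc hv x)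
  set p := wprox Q F x
  obtain ⟨b, hb⟩ : ∃ b : ℝ, F z = b :=
    ⟨_, (EReal.coe_toReal (ne_top_of_mem_ESubdiff hv hF_dom) (hF_bot z)).symm⟩
  have hp_top : F p ≠ ⊤ := by
    intro hp'
    have h₁ := hp z
    rw [hp', hb, EReal.top_add_coe, ← EReal.coe_add] at h₁
    exact EReal.coe_ne_top _ (top_le_iff.mp h₁)
  obtain ⟨a, ha⟩ : ∃ a : ℝ, F p = a := ⟨_, (EReal.coe_toReal hp_top (hF_bot p)).symm⟩
  have h₁ := hp.inner_add_le hQ_sa hF_conv ha hb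
  have h₂ := hv p
  rw [ha, hb] at h₂
  norm_cast at h₂
  have h₃ : ⟪v, p - z⟫ = -⟪v, z - p⟫ := by rw [← inner_neg_right, neg_sub]
  rw [inner_sub_left]
  linarith

/-- Weighted Young inequality: a dual-norm bound yields a bound on the pairing. -/
lemma inner_le_of_sqrt_le {Q Qinv : E →ₗ[ℝ] E} (hQ_sa : ∀ x y : E, ⟪Q x, y⟫ = ⟪x, Q y⟫)
    (hQ_nonneg : ∀ x : E, 0 ≤ ⟪Q x, x⟫) (hQQinv : ∀ x, Q (Qinv x) = x) {s : ℝ} (hs : 0 < s)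
    {d e : E} (h : √⟪Qinv d, d⟫ ≤ s * √⟪Q e, e⟫) : ⟪d, e⟫ ≤ s * ⟪Q e, e⟫ := by
  have hd : 0 ≤ ⟪Qinv d, d⟫ := by
    have := hQ_nonneg (Qinv d)
    rwa [hQQinv, real_inner_comm] at this
  have h₁ : ⟪Qinv d, d⟫ ≤ s ^ 2 * ⟪Q e, e⟫ := by
    rw [← Real.sq_sqrt hd, ← Real.sq_sqrt (hQ_nonneg e), ← mul_pow]
    exact pow_le_pow_left₀ (Real.sqrt_nonneg _) h 2
  have h₂ := hQ_nonneg (s • e - Qinv d)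
  have h₃ : ⟪Q e, Qinv d⟫ = ⟪d, e⟫ := by rw [hQ_sa, hQQinv, real_inner_comm]
  simp only [map_sub, map_smul, hQQinv, inner_sub_left, inner_sub_right, inner_smul_left,
    inner_smul_right, h₃, RCLike.conj_to_real] at h₂
  rw [real_inner_comm (Qinv d) d] at h₂
  refine le_of_mul_le_mul_left (a := s) ?_ hs
  linarith

end WeightedProx

section Smooth

variable {E : Type*} [NormedAddCommGroup E] [InnerProductSpace ℝ E] [CompleteSpace E]

lemma hasDerivAt_comp_add_smul {f : E → ℝ} (hf : Differentiable ℝ f) (x e : E) (t : ℝ) :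
    HasDerivAt (fun t : ℝ ↦ f (x + t • e)) ⟪gradient f (x + t • e), e⟫ t := by
  have h₁ : HasDerivAt (fun t : ℝ ↦ x + t • e) e t := by
    simpa using ((hasDerivAt_id t).smul_const e).const_add x
  exact (hf (x + t • e)).hasGradientAt.hasFDerivAt.comp_hasDerivAt t h₁

lemma ConvexOn.add_inner_gradient_le {f : E → ℝ} (hf_cvx : ConvexOn ℝ Set.univ f)
    (hf : Differentiable ℝ f) (x e : E) : f x + ⟪gradient f x, e⟫ ≤ f (x + e) := by
  have hline : ConvexOn ℝ Set.univ (fun t : ℝ ↦ f (x + t • e)) := by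
    have := hf_cvx.comp_affineMap (AffineMap.lineMap x (x + e) : ℝ →ᵃ[ℝ] E)
    simpa [Function.comp_def, AffineMap.lineMap_apply, add_comm] using this
  have hslope := hline.le_slope_of_hasDerivAt (Set.mem_univ 0) (Set.mem_univ 1) one_pos
    (hasDerivAt_comp_add_smul hf x e 0)
  simp only [slope_def_field, zero_smul, one_smul, add_zero, sub_zero, div_one] at hslope
  linarith

/-- Weighted descent lemma. -/
lemma le_add_inner_gradient_add {f : E → ℝ} (hf : Differentiable ℝ f) {Q Qinv : E →ₗ[ℝ] E}
    (hQ_sa : ∀ x y : E, ⟪Q x, y⟫ = ⟪x, Q y⟫) (hQ_nonneg : ∀ x : E, 0 ≤ ⟪Q x, x⟫)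
    (hQQinv : ∀ x, Q (Qinv x) = x) {β : ℝ} (hβ : 0 < β)
    (hf_lip : ∀ x y : E,
      √⟪Qinv (gradient f x - gradient f y), gradient f x - gradient f y⟫
        ≤ β * √⟪Q (x - y), x - y⟫) (x e : E) :
    f (x + e) ≤ f x + ⟪gradient f x, e⟫ + β / 2 * ⟪Q e, e⟫ := by
  have hderiv (t : ℝ) : HasDerivAt
      (fun t : ℝ ↦ f (x + t • e) - t * ⟪gradient f x, e⟫ - β / 2 * ⟪Q e, e⟫ * t ^ 2)
      (⟪gradient f (x + t • e), e⟫ - ⟪gradient f x, e⟫ - β * ⟪Q e, e⟫ * t) t := by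
    refine (((hasDerivAt_comp_add_smul hf x e t).sub
      ((hasDerivAt_id t).mul_const ⟪gradient f x, e⟫)).sub
      ((hasDerivAt_pow 2 t).const_mul (β / 2 * ⟪Q e, e⟫))).congr_deriv ?_
    push_cast
    ring
  have hanti := antitoneOn_of_deriv_nonpos (convex_Icc (0 : ℝ) 1)
    (fun t _ ↦ (hderiv t).continuousAt.continuousWithinAt)
    (fun t _ ↦ (hderiv t).differentiableAt.differentiableWithinAt) (fun t ht ↦ by
      rw [interior_Icc] at ht
      rw [(hderiv t).deriv]
      have h₁ := hf_lip (x + t • e) x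
      rw [add_sub_cancel_left] at h₁
      have h₂ := inner_le_of_sqrt_le hQ_sa hQ_nonneg hQQinv hβ h₁
      rw [map_smul, inner_smul_left, inner_smul_right, inner_smul_right, inner_sub_left,
        RCLike.conj_to_real] at h₂
      refine nonpos_of_mul_nonpos_right (a := t) ?_ ht.1
      linarith)
  have := hanti (Set.left_mem_Icc.mpr zero_le_one) (Set.right_mem_Icc.mpr zero_le_one) zero_le_one
  simp only [zero_smul, one_smul, add_zero] at this
  linarith

/-- Three-point consequence of cocoercivity of the gradient in a weighted norm. -/
lemma inner_gradient_sub_le {f : E → ℝ} (hf_cvx : ConvexOn ℝ Set.univ f)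
    (hf : Differentiable ℝ f) {Q Qinv : E →ₗ[ℝ] E}
    (hQ_sa : ∀ x y : E, ⟪Q x, y⟫ = ⟪x, Q y⟫) (hQ_nonneg : ∀ x : E, 0 ≤ ⟪Q x, x⟫)
    (hQQinv : ∀ x, Q (Qinv x) = x) {β : ℝ} (hβ : 0 < β)
    (hf_lip : ∀ x y : E,
      √⟪Qinv (gradient f x - gradient f y), gradient f x - gradient f y⟫
        ≤ β * √⟪Q (x - y), x - y⟫) (x y z : E) :
    ⟪gradient f x - gradient f y, y - z⟫ ≤ β / 4 * ⟪Q (z - x), z - x⟫ := by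
  set e : E := (1 / 2 : ℝ) • (z - x) with he
  have h₁ := le_add_inner_gradient_add hf hQ_sa hQ_nonneg hQQinv hβ hf_lip x e
  have h₂ := le_add_inner_gradient_add hf hQ_sa hQ_nonneg hQQinv hβ hf_lip y (-e)
  have h₃ := hf_cvx.add_inner_gradient_le hf y (x - y + e)
  have h₄ := hf_cvx.add_inner_gradient_le hf x (y - x - e)
  rw [show y + (x - y + e) = x + e by abel] at h₃
  rw [show x + (y - x - e) = y + -e by abel] at h₄
  have hq : ⟪Q e, e⟫ = 1 / 4 * ⟪Q (z - x), z - x⟫ := by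
    rw [he, map_smul, inner_smul_left, inner_smul_right, RCLike.conj_to_real]
    ring
  have hz : y - z = (y - x - e) - e := by rw [he]; module
  have hgoal : β / 4 * ⟪Q (z - x), z - x⟫ = β * ⟪Q e, e⟫ := by rw [hq]; ring
  rw [hz, hgoal]
  simp only [map_neg, inner_neg_left, inner_neg_right, inner_add_right, inner_sub_right,
    inner_sub_left, neg_neg] at h₁ h₂ h₃ h₄ ⊢
  linarith

end Smooth

/-- **Deterministic core inequality for the stochastic update.** With
`S(y,x) = (Σ⁻¹y, Γ⁻¹x)`, `U(y,x) = (Σ⁻¹y − (1/2)Lx, −(1/2)L*y + Γ⁻¹x − (β_f/4)Qx)`,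
a primal-dual solution `z* = (y*,x*)`, `ŷ = prox^{Σ⁻¹}_{h*}(y + ΣLx)`,
`x̂ = prox^{Γ⁻¹}_g(x − Γ(∇f(x) + w) − ΓL*ŷ)` and `t = (ŷ + ΣL(x̂ − x), x̂)`, one has
`⟨U(t − z), t − z⟩ ≤ ⟨S(t − z), z* − z⟩ + ⟨w, x* − x̂⟩` (inner products on `G × H`
written componentwise, `u = ŷ + ΣL(x̂ − x) − y` and `dx = x̂ − x` denoting the
components of `t − z`). -/
theorem deterministic_core_inequality
    {H G : Type*} [NormedAddCommGroup H] [InnerProductSpace ℝ H] [FiniteDimensional ℝ H]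
    [NormedAddCommGroup G] [InnerProductSpace ℝ G] [FiniteDimensional ℝ G]
    (f : H → ℝ) (hf_cvx : ConvexOn ℝ Set.univ f) (hf_smooth : ContDiff ℝ 1 f)
    (Q Qinv : H →ₗ[ℝ] H)
    (hQ_sa : ∀ x y : H, ⟪Q x, y⟫ = ⟪x, Q y⟫)
    (hQ_pd : ∀ x : H, x ≠ 0 → 0 < ⟪Q x, x⟫)
    (hQQinv : ∀ x : H, Q (Qinv x) = x) (hQinvQ : ∀ x : H, Qinv (Q x) = x)
    (βf : ℝ) (hβf : 0 < βf)
    (hf_lip : ∀ x y : H,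
      Real.sqrt ⟪Qinv (gradient f x - gradient f y), gradient f x - gradient f y⟫
        ≤ βf * Real.sqrt ⟪Q (x - y), x - y⟫)
    (g : H → EReal) (hg_proper : ERealProper g) (hg_conv : ERealConvexOn g)
    (hg_lsc : LowerSemicontinuous g)
    (h : G → EReal) (hh_proper : ERealProper h) (hh_conv : ERealConvexOn h)
    (hh_lsc : LowerSemicontinuous h)
    (L : H →ₗ[ℝ] G) (Ladj : G →ₗ[ℝ] H)
    (hadj : ∀ (x : H) (y : G), ⟪L x, y⟫ = ⟪x, Ladj y⟫)
    (Sg Sgi : G →ₗ[ℝ] G)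
    (hSg_sa : ∀ y y' : G, ⟪Sg y, y'⟫ = ⟪y, Sg y'⟫)
    (hSg_pd : ∀ y : G, y ≠ 0 → 0 < ⟪Sg y, y⟫)
    (hSgi : ∀ y : G, Sg (Sgi y) = y) (hSgi' : ∀ y : G, Sgi (Sg y) = y)
    (Ga Gai : H →ₗ[ℝ] H)
    (hGa_sa : ∀ x x' : H, ⟪Ga x, x'⟫ = ⟪x, Ga x'⟫)
    (hGa_pd : ∀ x : H, x ≠ 0 → 0 < ⟪Ga x, x⟫)
    (hGai : ∀ x : H, Ga (Gai x) = x) (hGai' : ∀ x : H, Gai (Ga x) = x)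
    (ystar : G) (xstar : H)
    (hz1 : L xstar ∈ ESubdiff (econj h) ystar)
    (hz2 : -(gradient f xstar + Ladj ystar) ∈ ESubdiff g xstar)
    (y : G) (x w : H) :
    ∀ (yh : G) (xh : H) (u : G) (dx : H),
      yh = wprox Sgi (econj h) (y + Sg (L x)) →
      xh = wprox Gai g (x - Ga (gradient f x + w) - Ga (Ladj yh)) →
      u = yh + Sg (L (xh - x)) - y →
      dx = xh - x →
      ⟪Sgi u - (1 / 2 : ℝ) • L dx, u⟫
          + ⟪-((1 / 2 : ℝ) • Ladj u) + Gai dx - (βf / 4) • Q dx, dx⟫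
        ≤ ⟪Sgi u, ystar - y⟫ + ⟪Gai dx, xstar - x⟫ + ⟪w, xstar - xh⟫ := by
  rintro yh xh u dx hyh hxh rfl rfl
  have hQ_nonneg (e : H) : 0 ≤ ⟪Q e, e⟫ := by
    rcases eq_or_ne e 0 with rfl | he
    · simp
    · exact (hQ_pd e he).le
  have hgrad := inner_gradient_sub_le hf_cvx (hf_smooth.differentiable one_ne_zero) hQ_sa
    hQ_nonneg hQQinv hβf hf_lip x xstar xh
  have hdual := inner_sub_wprox_le_zero hSg_sa hSg_pd hSgi (econj_ne_bot hh_proper)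
    (exists_econj_ne_top hh_proper hh_conv hh_lsc) (econj_convex hh_proper.1)
    (econj_lowerSemicontinuous hh_proper.1) hz1 (y + Sg (L x))
  have hprimal := inner_sub_wprox_le_zero hGa_sa hGa_pd hGai hg_proper.1 hg_proper.2
    hg_conv hg_lsc hz2 (x - Ga (gradient f x + w) - Ga (Ladj yh))
  rw [← hyh] at hdual
  rw [← hxh] at hprimal
  set s : G := Sgi (yh - y) with hs
  set d : H := xh - x with hd
  have hSgi_u : Sgi (yh + Sg (L d) - y) = s + L d := by
    rw [hs, show yh + Sg (L d) - y = (yh - y) + Sg (L d) by abel, map_add, hSgi']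
  have hu : yh + Sg (L d) - y = Sg (s + L d) := by rw [← hSgi_u, hSgi]
  have hystar : ystar - y = Sg (s + L d) - Sg (L d) - (yh - ystar) := by
    rw [map_add, hs, hSgi]
    abel
  have hxstar : xstar - x = d - (xh - xstar) := by
    rw [hd]
    abel
  have hcross : ⟪s + L d, Sg (L d)⟫ = ⟪L d, Sg (s + L d)⟫ := by
    rw [← hSg_sa, real_inner_comm]
  have hdual' : ⟪s, yh - ystar⟫ ≤ ⟪L x - L xstar, yh - ystar⟫ := by
    have heq : Sgi (y + Sg (L x) - yh) - L xstar = (L x - L xstar) - s := by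
      rw [hs]
      simp only [map_sub, map_add, hSgi']
      abel
    rw [heq, ← neg_sub yh ystar, inner_neg_right, inner_sub_left] at hdual
    linarith
  have hprimal' : ⟪Gai d, xh - xstar⟫ ≤
      ⟪gradient f x - gradient f xstar, xstar - xh⟫ + ⟪w, xstar - xh⟫
        - ⟪L xh - L xstar, yh - ystar⟫ := by
    have heq : Gai (x - Ga (gradient f x + w) - Ga (Ladj yh) - xh)
        - -(gradient f xstar + Ladj ystar) =
        -(Gai d) - (gradient f x - gradient f xstar) - w - Ladj (yh - ystar) := by
      rw [hd]
      simp only [map_sub, hGai']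
      abel
    have hL : ⟪L xh - L xstar, yh - ystar⟫ = -⟪Ladj (yh - ystar), xstar - xh⟫ := by
      rw [← map_sub, hadj, real_inner_comm, ← inner_neg_right, neg_sub]
    have hG : ⟪Gai d, xh - xstar⟫ = -⟪Gai d, xstar - xh⟫ := by
      rw [← inner_neg_right, neg_sub]
    rw [heq] at hprimal
    simp only [inner_sub_left (𝕜 := ℝ) (z := xstar - xh), inner_neg_left] at hprimal ⊢
    linarith
  have hLd : ⟪L d, yh - ystar⟫ =
      ⟪L xh - L xstar, yh - ystar⟫ - ⟪L x - L xstar, yh - ystar⟫ := by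
    rw [← inner_sub_left, hd, map_sub]
    congr 1
    abel
  have hLadj : ⟪Ladj (Sg (s + L d)), d⟫ = ⟪L d, Sg (s + L d)⟫ := by
    rw [hadj, real_inner_comm]
  rw [hSgi_u, hu, hystar, hxstar]
  generalize Sg (s + L d) = U at *
  rw [inner_sub_right (s + L d), inner_sub_right (s + L d), inner_sub_right (Gai d), hcross,
    inner_sub_left, inner_sub_left, inner_add_left (-((1 / 2 : ℝ) • Ladj U)), inner_neg_left,
    inner_add_left s (L d) (yh - ystar)]
  simp only [inner_smul_left, RCLike.conj_to_real, hLadj]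
  linarith
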